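/- Let γ ≥ 2, ε > 0 and M ≥ 0, and let ρ : ℝ³ → ℝ be measurable with ρ(x) ≥ 0 for a.e. x and ∫_{ℝ³} (ρ(x)^γ − 1 − γ(ρ(x) − 1)) dx ≤ ε²·M (the integrand is nonnegative a.e., so the integral is well defined as a Lebesgue integral of a nonnegative function). Then there exists a constant C > 0 depending only on γ such that ∫_{ℝ³} (ρ(x) − 1)² dx ≤ C·ε²·M. -/

import Mathlib

open MeasureTheory

/-- Quadratic lower bound for the relative internal energy, from Bernoulli's inequality applied to
`t ^ γ = (t ^ 2) ^ (γ / 2)`. -/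
theorem half_mul_sub_one_sq_le_rpow_sub {γ t : ℝ} (hγ : 2 ≤ γ) (ht : 0 ≤ t) :
    γ / 2 * (t - 1) ^ 2 ≤ t ^ γ - 1 - γ * (t - 1) := by
  have hb := one_add_mul_self_le_rpow_one_add (s := t ^ 2 - 1) (p := γ / 2)
    (by nlinarith) (by linarith)
  have hpow : (1 + (t ^ 2 - 1)) ^ (γ / 2) = t ^ γ := by
    rw [add_sub_cancel, ← Real.rpow_natCast, ← Real.rpow_mul ht]
    congr 1
    push_cast
    ring
  rw [hpow] at hb
  linarith

/-- For `γ ≥ 2` there is `C > 0` depending only on `γ` such that: for all `ε > 0`, `M ≥ 0`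
and every measurable a.e.-nonnegative `ρ : ℝ³ → ℝ` with
`∫ (ρ^γ − 1 − γ(ρ − 1)) ≤ ε²M` (as a Lebesgue integral of a nonnegative function),
one has `∫ (ρ − 1)² ≤ C ε² M`. -/
theorem stmt_4 (γ : ℝ) (hγ : 2 ≤ γ) :
    ∃ C : ℝ, 0 < C ∧ ∀ (ε M : ℝ), 0 < ε → 0 ≤ M →
      ∀ ρ : EuclideanSpace ℝ (Fin 3) → ℝ, Measurable ρ →
        (∀ᵐ x, 0 ≤ ρ x) →
        (∫⁻ x, ENNReal.ofReal (ρ x ^ γ - 1 - γ * (ρ x - 1))) ≤ ENNReal.ofReal (ε ^ 2 * M) →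
        (∫⁻ x, ENNReal.ofReal ((ρ x - 1) ^ 2)) ≤ ENNReal.ofReal (C * ε ^ 2 * M) := by
  refine ⟨1, one_pos, fun ε M _ _ ρ _ hρ hint => ?_⟩
  rw [one_mul]
  refine (lintegral_mono_ae ?_).trans hint
  filter_upwards [hρ] with x hx
  refine ENNReal.ofReal_le_ofReal ?_
  have h := half_mul_sub_one_sq_le_rpow_sub hγ hx
  nlinarith [sq_nonneg (ρ x - 1)]
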